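/- arXiv:2008.01368 — 2 statements merged into one kernel-verified Lean document; each statement's English description precedes it below -/
import Mathlib

section
/- The set 𝔾 = {x ∈ ℕ : gcd(x, P(x)) > 1} has natural density 0; in particular, for almost every positive integer x, x and P(x) are coprime. -/
open scoped Classical

/-- The largest element of ℙ*₁ = ℙ* ∪ {1} (prime-powers together with 1) not exceeding `x`. -/
noncomputable def q (x : ℕ) : ℕ :=
  sSup {m : ℕ | (IsPrimePow m ∨ m = 1) ∧ m ≤ x}

/-- The prime-power map. -/
noncomputable def P (x : ℕ) : ℕ :=
  if x = 1 then 1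
  else if IsPrimePow x then x / x.minFac
  else x - q x

/-- The orbit of `x` under `P`: `orbit x 1 = x` and `orbit x (n+1) = P (orbit x n)`. -/
noncomputable def orbit (x n : ℕ) : ℕ := P^[n - 1] x

/-- The transient length `T x = min {n ≥ 1 : x_n = 1}`. -/
noncomputable def T (x : ℕ) : ℕ := sInf {n : ℕ | 1 ≤ n ∧ orbit x n = 1}

/-- The settling time `S x = min {n ≥ 1 : x_n ∈ ℙ*₁}`. -/
noncomputable def S (x : ℕ) : ℕ :=
  sInf {n : ℕ | 1 ≤ n ∧ (IsPrimePow (orbit x n) ∨ orbit x n = 1)}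

section

open Filter Topology MeasureTheory Real FourierTransform Convolution

open ArithmeticFunction in
/-- The continuous extension of `-ζ'/ζ(s) - 1/(s-1)` to the closed half-plane `1 ≤ re s`. -/
lemma exists_continuousOn_LSeries_vonMangoldt_sub :
    ∃ F : ℂ → ℂ, ContinuousOn F {s | 1 ≤ s.re} ∧
      ∀ s : ℂ, 1 < s.re → LSeries (fun n ↦ (vonMangoldt n : ℂ)) s = F s + 1 / (s - 1) := by
  refine ⟨_, vonMangoldt.continuousOn_LFunctionResidueClassAux (1 : ZMod 1), fun s hs ↦ ?_⟩
  have h := vonMangoldt.eqOn_LFunctionResidueClassAux (q := 1) (a := 1) isUnit_one hs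
  have hres : (fun n ↦ ((vonMangoldt.residueClass (1 : ZMod 1) n : ℝ) : ℂ)) =
      fun n ↦ (vonMangoldt n : ℂ) := by
    funext n
    simp [vonMangoldt.residueClass, Subsingleton.elim _ (1 : ZMod 1)]
  simp only [hres] at h
  rw [h]
  simp

lemma fourier_char_smul (G : ℝ → ℂ) (y u : ℝ) :
    𝓕 (fun t ↦ (𝐞 (t * y) : ℂ) * G t) u = 𝓕 G (u - y) := by
  simp only [Real.fourier_real_eq, Circle.smul_def, smul_eq_mul, ← mul_assoc, ← Circle.coe_mul,
    ← AddChar.map_add_eq_mul]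
  refine integral_congr_ae (.of_forall fun t ↦ ?_)
  ring_nf

lemma natCast_cpow_neg_eq {n : ℕ} (hn : n ≠ 0) (σ t : ℝ) :
    (n : ℂ) ^ (-(σ + 2 * π * t * Complex.I)) =
      ((n : ℝ) ^ (-σ) : ℝ) * (𝐞 (-(t * Real.log n)) : ℂ) := by
  have hn' : (n : ℂ) ≠ 0 := by exact_mod_cast hn
  have : (0:ℝ) < n := by positivity
  rw [Real.fourierChar_apply, Complex.cpow_def_of_ne_zero hn', Real.rpow_def_of_pos this,
    Complex.ofReal_exp, ← Complex.exp_add, ← Complex.natCast_log]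
  congr 1
  push_cast
  ring

open ArithmeticFunction in
lemma integral_mul_LSeries_vonMangoldt {G : ℝ → ℂ} (hG : Integrable G) {σ : ℝ} (hσ : 1 < σ) :
    ∫ t : ℝ, G t * LSeries (fun n ↦ (vonMangoldt n : ℂ)) (σ + 2 * π * t * Complex.I) =
      ∑' n : ℕ, ((vonMangoldt n * (n : ℝ) ^ (-σ) : ℝ) : ℂ) * 𝓕 G (Real.log n) := by
  have hterm (n : ℕ) (t : ℝ) :
      G t * LSeries.term (fun n ↦ (vonMangoldt n : ℂ)) (σ + 2 * π * t * Complex.I) n =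
        ((vonMangoldt n * (n : ℝ) ^ (-σ) : ℝ) : ℂ) * ((𝐞 (-(t * Real.log n)) : ℂ) * G t) := by
    rcases eq_or_ne n 0 with rfl | hn
    · simp
    · rw [LSeries.term_of_ne_zero hn, div_eq_mul_inv, ← Complex.cpow_neg, natCast_cpow_neg_eq hn]
      push_cast
      ring
  have hint (n : ℕ) : Integrable fun t : ℝ ↦ (𝐞 (-(t * Real.log n)) : ℂ) * G t := by
    simpa [Circle.smul_def, mul_comm] using
      (Real.fourierIntegral_convergent_iff (μ := volume) (f := G) (Real.log n)).2 hG
  have hsum : Summable fun n : ℕ ↦ vonMangoldt n * (n : ℝ) ^ (-σ) := by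
    have := (LSeriesSummable_vonMangoldt (s := σ) (by simpa using hσ)).norm
    refine this.congr fun n ↦ ?_
    rcases eq_or_ne n 0 with rfl | hn
    · simp
    · have : (0:ℝ) < n := by positivity
      rw [LSeries.norm_term_eq, if_neg hn, Complex.ofReal_re, Real.rpow_neg this.le]
      simp [abs_of_nonneg vonMangoldt_nonneg, div_eq_mul_inv]
  simp only [LSeries, ← tsum_mul_left, hterm]
  rw [← integral_tsum_of_summable_integral_norm]
  · refine tsum_congr fun n ↦ ?_
    rw [integral_const_mul, Real.fourier_real_eq]
    simp [Circle.smul_def]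
  · exact fun n ↦ (hint n).const_mul _
  · simp only [norm_mul, Complex.norm_real, Circle.norm_coe, one_mul, integral_const_mul]
    simpa only [norm_mul] using hsum.norm.mul_right (∫ t, ‖G t‖)

lemma integral_div_eq_integral_exp_mul_fourier {G : ℝ → ℂ} (hG : Integrable G) {a : ℝ}
    (ha : 0 < a) :
    ∫ t : ℝ, G t * (1 / (a + 2 * π * t * Complex.I)) =
      ∫ u in Set.Ioi (0 : ℝ), (Real.exp (-a * u) : ℂ) * 𝓕 G u := by
  have hf : Integrable (Set.indicator (Set.Ioi (0 : ℝ)) fun u ↦ (Real.exp (-a * u) : ℂ)) := by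
    rw [integrable_indicator_iff measurableSet_Ioi]
    exact (integrableOn_exp_mul_Ioi (by linarith) 0).ofReal
  have hF (t : ℝ) : 𝓕 (Set.indicator (Set.Ioi (0 : ℝ)) fun u ↦ (Real.exp (-a * u) : ℂ)) t =
      1 / (a + 2 * π * t * Complex.I) := by
    have hre : (-(a + 2 * π * t * Complex.I)).re < 0 := by simpa using ha
    have := integral_exp_mul_complex_Ioi hre 0
    rw [Real.fourier_real_eq]
    trans ∫ u in Set.Ioi (0 : ℝ), Complex.exp (-(a + 2 * π * t * Complex.I) * u)
    · rw [← integral_indicator measurableSet_Ioi]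
      congr with u
      by_cases hu : u ∈ Set.Ioi (0 : ℝ)
      · simp only [Set.indicator_of_mem hu, Circle.smul_def, Real.fourierChar_apply, smul_eq_mul,
          Complex.ofReal_exp, ← Complex.exp_add]
        congr 1
        push_cast
        ring
      · simp [Set.indicator_of_notMem hu]
    · rw [this, neg_div_neg_eq]
      simp
  have key := VectorFourier.integral_fourierIntegral_smul_eq_flip (L := innerₗ ℝ)
    continuous_fourierChar continuous_inner hf hG
  rw [← integral_indicator measurableSet_Ioi]
  trans ∫ t : ℝ, 𝓕 (Set.indicator (Set.Ioi (0 : ℝ)) fun u ↦ (Real.exp (-a * u) : ℂ)) t • G t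
  · congr with t
    rw [hF, smul_eq_mul, mul_comm]
  · refine (key.trans ?_)
    congr with u
    simp only [Set.indicator_apply]
    split_ifs
    · simp; rfl
    · simp

lemma tendsto_integral_mul_comp_vertical {F : ℂ → ℂ} (hF : ContinuousOn F {s | 1 ≤ s.re})
    {G : ℝ → ℂ} (hG : Continuous G) (hGc : HasCompactSupport G) :
    Tendsto (fun σ : ℝ ↦ ∫ t : ℝ, G t * F (σ + 2 * π * t * Complex.I)) (𝓝[>] 1)
      (𝓝 (∫ t : ℝ, G t * F ((1 : ℝ) + 2 * π * t * Complex.I))) := by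
  have hmaps : Set.MapsTo (fun p : ℝ × ℝ ↦ (p.1 + 2 * π * p.2 * Complex.I : ℂ))
      (Set.Ici 1 ×ˢ Set.univ) {s | 1 ≤ s.re} := by
    rintro ⟨σ, t⟩ ⟨hσ, -⟩
    simpa using hσ
  have hcont : ContinuousOn (fun p : ℝ × ℝ ↦ F (p.1 + 2 * π * p.2 * Complex.I))
      (Set.Ici 1 ×ˢ Set.univ) := hF.comp (by fun_prop) hmaps
  have hslice {σ : ℝ} (hσ : 1 ≤ σ) : Continuous fun t : ℝ ↦ F (σ + 2 * π * t * Complex.I) := by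
    rw [← continuousOn_univ]
    exact hcont.comp (f := fun t : ℝ ↦ (σ, t)) (by fun_prop) fun t _ ↦ ⟨hσ, trivial⟩
  obtain ⟨C, hC⟩ := (isCompact_Icc (a := (1 : ℝ)) (b := 2)).prod hGc.isCompact
    |>.exists_bound_of_continuousOn
      (hcont.mono (Set.prod_mono Set.Icc_subset_Ici_self (Set.subset_univ _)))
  have hmem : ∀ᶠ σ : ℝ in 𝓝[>] 1, σ ∈ Set.Ioc (1 : ℝ) 2 := Ioc_mem_nhdsGT (by norm_num)
  refine tendsto_integral_filter_of_dominated_convergence (fun t ↦ C * ‖G t‖) ?_ ?_ ?_ ?_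
  · filter_upwards [hmem] with σ hσ
    exact (hG.mul (hslice hσ.1.le)).aestronglyMeasurable
  · filter_upwards [hmem] with σ hσ
    refine .of_forall fun t ↦ ?_
    by_cases ht : t ∈ tsupport G
    · rw [norm_mul, mul_comm]
      exact mul_le_mul_of_nonneg_right (hC (σ, t) ⟨⟨hσ.1.le, hσ.2⟩, ht⟩) (norm_nonneg _)
    · simp [image_eq_zero_of_notMem_tsupport ht]
  · exact ((hG.integrable_of_hasCompactSupport hGc).norm).const_mul C
  · refine .of_forall fun t ↦ Tendsto.const_mul _ ?_
    have h1 := hcont.comp (f := fun σ : ℝ ↦ (σ, t)) (s := Set.Ici 1) (by fun_prop)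
      fun σ hσ ↦ ⟨hσ, trivial⟩
    exact (h1 1 Set.self_mem_Ici).tendsto.mono_left (nhdsWithin_mono _ Set.Ioi_subset_Ici_self)

lemma tendsto_integral_exp_neg_mul {g : ℝ → ℝ} (hg : IntegrableOn g (Set.Ioi 0)) :
    Tendsto (fun σ : ℝ ↦ ∫ u in Set.Ioi (0 : ℝ), Real.exp (-(σ - 1) * u) * g u) (𝓝[>] 1)
      (𝓝 (∫ u in Set.Ioi (0 : ℝ), g u)) := by
  refine tendsto_integral_filter_of_dominated_convergence (fun u ↦ ‖g u‖) ?_ ?_ hg.norm ?_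
  · exact .of_forall fun σ ↦ (by fun_prop : Continuous fun u ↦ Real.exp (-(σ - 1) * u))
      |>.aestronglyMeasurable.mul hg.aestronglyMeasurable
  · filter_upwards [self_mem_nhdsWithin] with σ hσ
    filter_upwards [ae_restrict_mem measurableSet_Ioi] with u hu
    rw [norm_mul, Real.norm_of_nonneg (Real.exp_nonneg _)]
    refine mul_le_of_le_one_left (norm_nonneg _) (Real.exp_le_one_iff.2 ?_)
    have := mul_nonneg (sub_pos.2 (Set.mem_Ioi.1 hσ)).le (Set.mem_Ioi.1 hu).le
    linarith
  · refine .of_forall fun u ↦ ?_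
    have : Tendsto (fun σ : ℝ ↦ Real.exp (-(σ - 1) * u) * g u) (𝓝 1)
        (𝓝 (Real.exp (-(1 - 1) * u) * g u)) := (by fun_prop : Continuous _).tendsto 1
    simpa using this.mono_left nhdsWithin_le_nhds

lemma tendsto_integral_Ioi_comp_sub {g : ℝ → ℝ} (hg : Integrable g) :
    Tendsto (fun y : ℝ ↦ ∫ u in Set.Ioi (0 : ℝ), g (u - y)) atTop (𝓝 (∫ u, g u)) := by
  have h := (aecover_Ioi (μ := volume) tendsto_neg_atTop_atBot)
    |>.integral_tendsto_of_countably_generated hg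
  refine h.congr fun y ↦ ?_
  rw [← integral_indicator measurableSet_Ioi, ← integral_indicator measurableSet_Ioi,
    ← integral_sub_right_eq_self _ y]
  congr with u
  simp [Set.indicator_apply]

open ArithmeticFunction in
/-- A smoothed form of the prime number theorem: a band-limited weight of positive mass, translated
far enough to the right, is positive at the logarithm of some prime power. -/
lemma eventually_exists_vonMangoldt_mul_pos {G : ℝ → ℂ} (hG : Continuous G)
    (hGc : HasCompactSupport G) {g : ℝ → ℝ} (hGg : ∀ u, 𝓕 G u = g u) (hg : Integrable g)
    (hpos : 0 < ∫ u, g u) :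
    ∀ᶠ y in atTop, ∃ n : ℕ, 0 < vonMangoldt n * g (Real.log n - y) := by
  obtain ⟨F, hF, hFeq⟩ := exists_continuousOn_LSeries_vonMangoldt_sub
  have hlim : Tendsto (fun y : ℝ ↦ (∫ u in Set.Ioi (0 : ℝ), g (u - y)) +
      (∫ t : ℝ, ((𝐞 (t * y) : ℂ) * G t) * F ((1 : ℝ) + 2 * π * t * Complex.I)).re) atTop
      (𝓝 (∫ u, g u)) := by
    have h := (Real.zero_at_infty_fourier
      fun t : ℝ ↦ G t * F ((1 : ℝ) + 2 * π * t * Complex.I)).comp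
      (tendsto_neg_atTop_atBot.mono_right atBot_le_cocompact)
    have h' := (tendsto_integral_Ioi_comp_sub hg).add ((Complex.continuous_re.tendsto 0).comp h)
    rw [Complex.zero_re, add_zero] at h'
    refine h'.congr fun y ↦ ?_
    simp only [Function.comp_apply, Real.fourier_real_eq, Circle.smul_def, smul_eq_mul, mul_neg,
      neg_neg, mul_assoc]
  filter_upwards [hlim.eventually (lt_mem_nhds hpos)] with y hy
  by_contra! hneg
  refine hy.not_ge ?_
  set Gy : ℝ → ℂ := fun t ↦ (𝐞 (t * y) : ℂ) * G t with hGy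
  have hGyc : Continuous Gy := by
    have : Continuous fun t : ℝ ↦ (𝐞 (t * y) : ℂ) := by
      simp only [Real.fourierChar_apply]
      fun_prop
    exact this.mul hG
  have hGys : HasCompactSupport Gy := hGc.mul_left
  have hGyi : Integrable Gy := hGyc.integrable_of_hasCompactSupport hGys
  have hFGy (u : ℝ) : 𝓕 Gy u = g (u - y) := by rw [hGy, fourier_char_smul, hGg]
  have hlim' := (tendsto_integral_exp_neg_mul (hg.comp_sub_right y).integrableOn).add
    ((Complex.continuous_re.tendsto _).comp (tendsto_integral_mul_comp_vertical hF hGyc hGys))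
  refine le_of_tendsto hlim' ?_
  filter_upwards [self_mem_nhdsWithin] with σ hσ
  replace hσ : 1 < σ := hσ
  have hre (t : ℝ) : 1 < (σ + 2 * π * t * Complex.I : ℂ).re := by simpa using hσ
  have hFcont : Continuous fun t : ℝ ↦ F (σ + 2 * π * t * Complex.I) := by
    rw [← continuousOn_univ]
    exact hF.comp (by fun_prop) fun t _ ↦ (hre t).le
  have hpole (t : ℝ) : (σ - 1 : ℝ) + 2 * π * t * Complex.I ≠ 0 := fun h ↦ by
    have := congrArg Complex.re h
    simp at this
    linarith
  have hpcont : Continuous fun t : ℝ ↦ 1 / ((σ - 1 : ℝ) + 2 * π * t * Complex.I) :=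
    continuous_const.div (by fun_prop) hpole
  have h1 := integral_mul_LSeries_vonMangoldt hGyi hσ
  have h2 := integral_div_eq_integral_exp_mul_fourier hGyi (sub_pos.2 hσ)
  have hsplit : ∫ t : ℝ, Gy t * LSeries (fun n ↦ (vonMangoldt n : ℂ)) (σ + 2 * π * t * Complex.I) =
      (∫ t : ℝ, Gy t * F (σ + 2 * π * t * Complex.I)) +
        ∫ t : ℝ, Gy t * (1 / ((σ - 1 : ℝ) + 2 * π * t * Complex.I)) := by
    rw [← integral_add]
    · congr with t
      rw [hFeq _ (hre t)]
      push_cast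
      ring_nf
    · exact (hGyc.mul hFcont).integrable_of_hasCompactSupport hGys.mul_right
    · exact (hGyc.mul hpcont).integrable_of_hasCompactSupport hGys.mul_right
  simp only [hFGy, ← Complex.ofReal_mul, integral_complex_ofReal, ← Complex.ofReal_tsum] at h1 h2
  rw [h1, h2] at hsplit
  have hsplit' := congrArg Complex.re hsplit
  rw [Complex.add_re, Complex.ofReal_re, Complex.ofReal_re] at hsplit'
  rw [Function.comp_apply, add_comm, ← hsplit']
  refine tsum_nonpos fun n ↦ ?_
  rw [mul_right_comm]
  exact mul_nonpos_of_nonpos_of_nonneg (hneg n) (by positivity)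

lemma exists_schwartz_even_fourier_real :
    ∃ φ : SchwartzMap ℝ ℂ, HasCompactSupport φ ∧ 0 < ∫ u, ‖𝓕 φ u‖ ^ 2 ∧
      ∀ u, 𝓕 (φ : ℝ → ℂ) u ^ 2 = (‖𝓕 φ u‖ ^ 2 : ℝ) := by
  let f : ContDiffBump (0 : ℝ) := ⟨1, 2, one_pos, one_lt_two⟩
  have hfc : HasCompactSupport fun t ↦ (f t : ℂ) :=
    f.hasCompactSupport.comp_left (g := ((↑) : ℝ → ℂ)) Complex.ofReal_zero
  refine ⟨hfc.toSchwartzMap (Complex.ofRealCLM.contDiff.comp f.contDiff), hfc, ?_, fun u ↦ ?_⟩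
  · rw [SchwartzMap.integral_norm_sq_fourier]
    have hc : Continuous fun t ↦ f t ^ 2 := f.continuous.pow 2
    have hcs : HasCompactSupport fun t ↦ f t ^ 2 :=
      f.hasCompactSupport.comp_left (g := fun x : ℝ ↦ x ^ 2) (by simp)
    have h0 : f 0 ^ 2 ≠ 0 := by
      rw [f.one_of_mem_closedBall (by simp [f])]
      norm_num
    have hpos : 0 < ∫ t, f t ^ 2 :=
      hc.integral_pos_of_hasCompactSupport_nonneg_nonzero hcs (fun _ ↦ sq_nonneg _) h0
    refine hpos.trans_eq (integral_congr_ae (.of_forall fun t ↦ ?_))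
    change f t ^ 2 = ‖(f t : ℂ)‖ ^ 2
    simp
  · have hreal : (starRingEnd ℂ) (𝓕 (fun t ↦ (f t : ℂ)) u) = 𝓕 (fun t ↦ (f t : ℂ)) u := by
      rw [Real.fourier_real_eq, ← integral_conj, ← integral_neg_eq_self]
      congr with t
      simp [Circle.smul_def, f.neg, ← Circle.coe_inv_eq_conj, ← AddChar.map_neg_eq_inv]
    rw [SchwartzMap.fourier_coe]
    change 𝓕 (fun t ↦ (f t : ℂ)) u ^ 2 = (‖𝓕 (fun t ↦ (f t : ℂ)) u‖ ^ 2 : ℝ)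
    rw [Complex.ofReal_pow, ← Complex.mul_conj', hreal, sq]

lemma integrable_norm_sq_schwartz (φ : SchwartzMap ℝ ℂ) : Integrable fun u ↦ ‖φ u‖ ^ 2 :=
  (φ.memLp 2 volume).integrable_norm_pow two_ne_zero

/-- A band-limited function of positive mass that is nonpositive outside `(-A, A)`. -/
lemma exists_bandlimited_nonpos_outside_some :
    ∃ (G : ℝ → ℂ) (g : ℝ → ℝ) (A : ℝ), Continuous G ∧ HasCompactSupport G ∧
      (∀ u, 𝓕 G u = g u) ∧ Integrable g ∧ 0 < ∫ u, g u ∧ 0 < A ∧ ∀ u, A ≤ |u| → g u ≤ 0 := by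
  obtain ⟨φ, hφc, hφpos, hφsq⟩ := exists_schwartz_even_fourier_real
  have hdc : HasCompactSupport (deriv φ) := hφc.deriv
  have hdcont : Continuous (deriv φ) := (φ.smooth 1).continuous_deriv le_rfl
  have hdi : Integrable (deriv φ) := hdcont.integrable_of_hasCompactSupport hdc
  have hFd (u : ℝ) : 𝓕 (deriv φ) u = (2 * π * Complex.I * u) * 𝓕 (φ : ℝ → ℂ) u := by
    rw [Real.fourier_deriv φ.integrable φ.differentiable hdi]
    rfl
  have hdS : SchwartzMap.derivCLM ℂ ℂ φ = deriv φ := by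
    ext u; simp
  have hi1 := integrable_norm_sq_schwartz (𝓕 φ)
  have hi2 : Integrable fun u : ℝ ↦ u ^ 2 * ‖𝓕 φ u‖ ^ 2 := by
    refine ((integrable_norm_sq_schwartz (𝓕 (SchwartzMap.derivCLM ℂ ℂ φ))).const_mul
      ((2 * π)⁻¹ ^ 2)).congr (.of_forall fun u ↦ ?_)
    simp only [SchwartzMap.fourier_coe, hdS, hFd]
    simp only [norm_mul, Complex.norm_ofNat, Complex.norm_real, Complex.norm_I,
      norm_of_nonneg pi_nonneg, mul_pow, Real.norm_eq_abs, sq_abs]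
    field_simp
  set I₁ := ∫ u, ‖𝓕 φ u‖ ^ 2 with hI₁
  set I₂ := ∫ u : ℝ, u ^ 2 * ‖𝓕 φ u‖ ^ 2 with hI₂
  have hI₂' : 0 ≤ I₂ := integral_nonneg fun u ↦ by positivity
  set A := √(I₂ / I₁ + 1)
  have hA : A ^ 2 = I₂ / I₁ + 1 := Real.sq_sqrt (by positivity)
  let M := ContinuousLinearMap.mul ℂ ℂ
  refine ⟨fun t ↦ A ^ 2 * (φ ⋆[M] φ) t + (2 * π)⁻¹ ^ 2 * (deriv φ ⋆[M] deriv φ) t,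
    fun u ↦ A ^ 2 * ‖𝓕 φ u‖ ^ 2 - u ^ 2 * ‖𝓕 φ u‖ ^ 2, A, ?_, ?_, fun u ↦ ?_, ?_, ?_, ?_, ?_⟩
  · have h1 := hφc.continuous_convolution_right (μ := volume) M
      φ.integrable.locallyIntegrable φ.continuous
    have h2 := hdc.continuous_convolution_right M hdi.locallyIntegrable hdcont
    fun_prop
  · exact ((hφc.convolution M hφc).mul_left).add ((hdc.convolution M hdc).mul_left)
  · have h1 : Integrable (φ ⋆[M] φ) := φ.integrable.integrable_convolution M φ.integrable
    have h2 : Integrable (deriv φ ⋆[M] deriv φ) := hdi.integrable_convolution M hdi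
    have e1 := Real.fourier_mul_convolution_eq φ.integrable φ.integrable u
    have e2 := Real.fourier_mul_convolution_eq hdi hdi u
    have hconv {f : ℝ → ℂ} (hf : Integrable f) : Integrable fun t ↦ 𝐞 (-(t * u)) • f t := by
      simpa [mul_comm] using (Real.fourierIntegral_convergent_iff u).2 hf
    have : 𝓕 (fun t ↦ A ^ 2 * (φ ⋆[M] φ) t + (2 * π)⁻¹ ^ 2 * (deriv φ ⋆[M] deriv φ) t) u =
        A ^ 2 * 𝓕 (φ ⋆[M] φ) u + (2 * π)⁻¹ ^ 2 * 𝓕 (deriv φ ⋆[M] deriv φ) u := by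
      simp only [Real.fourier_real_eq, ← integral_const_mul]
      rw [← integral_add]
      · congr with t
        simp only [Circle.smul_def, smul_eq_mul]
        ring
      · exact (hconv h1).const_mul _
      · exact (hconv h2).const_mul _
    rw [this, e1, e2, hFd]
    have hsq := hφsq u
    have hpi : (π : ℂ) ≠ 0 := by exact_mod_cast pi_ne_zero
    have hinv : ((2 * π : ℂ)⁻¹) ^ 2 * (2 * π) ^ 2 = 1 := by field_simp
    push_cast at hsq ⊢
    rw [← hsq]
    linear_combination (u ^ 2 * 𝓕 (φ : ℝ → ℂ) u ^ 2) *
      (((2 * π : ℂ)⁻¹) ^ 2 * (2 * π) ^ 2 * Complex.I_sq - hinv)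
  · exact (hi1.const_mul _).sub hi2
  · rw [integral_sub (hi1.const_mul _) hi2, integral_const_mul, ← hI₁, ← hI₂, hA, add_mul,
      div_mul_cancel₀ _ hφpos.ne']
    linarith
  · positivity
  · intro u hu
    have : A ^ 2 ≤ u ^ 2 := by
      rw [← sq_abs u]
      gcongr
    nlinarith [sq_nonneg ‖𝓕 φ u‖]

lemma exists_bandlimited_nonpos_outside {δ : ℝ} (hδ : 0 < δ) :
    ∃ (G : ℝ → ℂ) (g : ℝ → ℝ), Continuous G ∧ HasCompactSupport G ∧
      (∀ u, 𝓕 G u = g u) ∧ Integrable g ∧ 0 < ∫ u, g u ∧ ∀ u, δ ≤ |u| → g u ≤ 0 := by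
  obtain ⟨G, g, A, hG, hGc, hGg, hg, hpos, hA, hneg⟩ := exists_bandlimited_nonpos_outside_some
  set c := A / δ
  have hc : 0 < c := by positivity
  refine ⟨fun t ↦ c⁻¹ * G (t / c), fun u ↦ g (u * c), by fun_prop, ?_, fun u ↦ ?_,
    hg.comp_mul_right' hc.ne', ?_, fun u hu ↦ hneg _ ?_⟩
  · have := hGc.comp_homeomorph (Homeomorph.mulRight₀ c⁻¹ (inv_ne_zero hc.ne'))
    exact HasCompactSupport.mul_left (by simpa [Function.comp_def, div_eq_mul_inv] using this)
  · rw [← hGg, Real.fourier_real_eq, Real.fourier_real_eq]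
    have := Measure.integral_comp_div (fun s ↦ 𝐞 (-(s * (u * c))) • G s) c
    rw [abs_of_pos hc, Complex.real_smul] at this
    rw [← inv_mul_cancel_left₀ (by exact_mod_cast hc.ne' : (c : ℂ) ≠ 0)
      (∫ v : ℝ, 𝐞 (-(v * (u * c))) • G v), ← this, ← integral_const_mul]
    congr with t
    rw [Circle.smul_def, Circle.smul_def, smul_eq_mul, smul_eq_mul]
    rw [show t / c * (u * c) = t * u by field_simp]
    push_cast
    ring
  · rw [Measure.integral_comp_mul_right, smul_eq_mul]
    positivity
  · rw [abs_mul, abs_of_pos hc]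
    calc A = δ * c := by simp only [c]; field_simp
      _ ≤ _ := by gcongr

/-- Every interval `(x, (1 + ε) x]` with `x` large contains a prime power. -/
lemma exists_isPrimePow_between {ε : ℝ} (hε : 0 < ε) :
    ∃ X : ℕ, ∀ x : ℕ, X ≤ x → ∃ n : ℕ, IsPrimePow n ∧ x < n ∧ (n : ℝ) ≤ (1 + ε) * x := by
  have hlog : 0 < Real.log (1 + ε) := Real.log_pos (by linarith)
  obtain ⟨G, g, hG, hGc, hGg, hg, hpos, hneg⟩ := exists_bandlimited_nonpos_outside
    (half_pos hlog)
  obtain ⟨Y, hY⟩ := eventually_atTop.1 (eventually_exists_vonMangoldt_mul_pos hG hGc hGg hg hpos)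
  have hlim := Real.tendsto_log_atTop.comp (tendsto_natCast_atTop_atTop (R := ℝ))
  obtain ⟨X, hX⟩ := eventually_atTop.1
    ((hlim.eventually_ge_atTop Y).and (eventually_ge_atTop 1))
  refine ⟨X, fun x hx ↦ ?_⟩
  obtain ⟨hxY, hx1⟩ := hX x hx
  simp only [Function.comp_apply] at hxY
  obtain ⟨n, hn⟩ := hY (Real.log x + Real.log (1 + ε) / 2) (by linarith)
  have hΛ := ArithmeticFunction.vonMangoldt_nonneg (n := n)
  have hΛ0 : ArithmeticFunction.vonMangoldt n ≠ 0 := fun h ↦ by simp [h] at hn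
  have hpp : IsPrimePow n := ArithmeticFunction.vonMangoldt_ne_zero_iff.1 hΛ0
  have hnear : |Real.log n - (Real.log x + Real.log (1 + ε) / 2)| < Real.log (1 + ε) / 2 := by
    by_contra! h
    exact hn.not_ge (mul_nonpos_of_nonneg_of_nonpos hΛ (hneg _ h))
  rw [abs_lt] at hnear
  have hx0 : (0 : ℝ) < x := by exact_mod_cast hx1
  have hn0 : (0 : ℝ) < n := by exact_mod_cast hpp.pos
  refine ⟨n, hpp, ?_, ?_⟩
  · have : Real.log x < Real.log n := by linarith
    exact_mod_cast (Real.log_lt_log_iff hx0 hn0).1 this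
  · rw [← Real.log_le_log_iff hn0 (by positivity), Real.log_mul (by positivity) hx0.ne']
    linarith

lemma q_mem {x : ℕ} (hx : 1 ≤ x) : (IsPrimePow (q x) ∨ q x = 1) ∧ q x ≤ x :=
  Nat.sSup_mem (s := {m : ℕ | (IsPrimePow m ∨ m = 1) ∧ m ≤ x}) ⟨1, Or.inr rfl, hx⟩
    ⟨x, fun _ hm ↦ hm.2⟩

lemma le_q {m x : ℕ} (hm : IsPrimePow m ∨ m = 1) (hmx : m ≤ x) : m ≤ q x :=
  le_csSup (s := {m : ℕ | (IsPrimePow m ∨ m = 1) ∧ m ≤ x}) ⟨x, fun _ h ↦ h.2⟩ ⟨hm, hmx⟩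

lemma isPrimePow_q {x : ℕ} (hx : 2 ≤ x) : IsPrimePow (q x) :=
  (q_mem (one_le_two.trans hx)).1.resolve_right fun h ↦ by
    have := le_q (.inl Nat.prime_two.isPrimePow) hx
    omega

lemma q_eq_self {x : ℕ} (hx : IsPrimePow x) : q x = x :=
  le_antisymm (q_mem hx.pos).2 (le_q (.inl hx) le_rfl)

lemma q_eq_of_le_of_le {x y : ℕ} (hx : 1 ≤ x) (hxy : q x ≤ y) (hyx : y ≤ x) : q y = q x := by
  have h1 : 1 ≤ y := (le_q (.inr rfl) hx).trans hxy
  have hy := q_mem h1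
  exact le_antisymm (le_q hy.1 (hy.2.trans hyx)) (le_q (q_mem hx).1 hxy)

lemma minFac_q_dvd_of_one_lt_gcd {x : ℕ} (hx : 2 ≤ x) (hpp : ¬IsPrimePow x)
    (h : 1 < Nat.gcd x (P x)) : (q x).minFac ∣ x := by
  obtain ⟨r, hr, hrg⟩ := Nat.exists_prime_and_dvd h.ne'
  have hrx := hrg.trans (Nat.gcd_dvd_left _ _)
  have hrP := hrg.trans (Nat.gcd_dvd_right _ _)
  rw [P, if_neg (by omega), if_neg hpp] at hrP
  have hrq : r ∣ q x := (Nat.dvd_sub_iff_right (q_mem (by omega)).2 hrx).1 hrP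
  obtain ⟨p, k, hp, hk, hpk⟩ := (isPrimePow_nat_iff _).1 (isPrimePow_q hx)
  rw [← hpk] at hrq ⊢
  rw [hp.pow_minFac hk.ne', ← (Nat.prime_dvd_prime_iff_eq hr hp).1 (hr.dvd_of_dvd_pow hrq)]
  exact hrx

lemma card_isPrimePow_mul_log_le (M N : ℕ) :
    (((Finset.Icc 1 N).filter fun x ↦ IsPrimePow x ∧ M ≤ x.minFac).card : ℝ) * Real.log M ≤
      (Real.log 4 + 4) * N := by
  rcases Nat.eq_zero_or_pos M with rfl | hM
  · simp; positivity
  refine le_trans ?_ (Chebyshev.psi_le_const_mul_self (Nat.cast_nonneg N))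
  rw [Chebyshev.psi, Nat.floor_natCast, ← nsmul_eq_mul]
  refine (Finset.card_nsmul_le_sum _ ArithmeticFunction.vonMangoldt _ fun x hx ↦ ?_).trans
    (Finset.sum_le_sum_of_subset_of_nonneg (fun x hx ↦ ?_)
      fun _ _ _ ↦ ArithmeticFunction.vonMangoldt_nonneg)
  · obtain ⟨-, hpp, hMx⟩ := Finset.mem_filter.1 hx
    rw [ArithmeticFunction.vonMangoldt_apply, if_pos hpp]
    exact Real.log_le_log (by exact_mod_cast hM) (by exact_mod_cast hMx)
  · have := (Finset.mem_filter.1 hx).1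
    simp only [Finset.mem_Icc, Finset.mem_Ioc] at this ⊢
    omega

/-- Distinct `x` counted here are separated by at least `M` inside each gap between prime powers,
so that the blocks `(x - M, x]` are disjoint. -/
lemma mul_card_minFac_q_dvd_le (M N : ℕ) :
    M * ((Finset.Icc 1 N).filter fun x ↦
      ¬IsPrimePow x ∧ M ≤ (q x).minFac ∧ (q x).minFac ∣ x).card ≤ N := by
  set A := (Finset.Icc 1 N).filter fun x ↦
    ¬IsPrimePow x ∧ M ≤ (q x).minFac ∧ (q x).minFac ∣ x
  have key {x i : ℕ} (hx : x ∈ A) (hi : i < M) : 1 ≤ x - i ∧ i < x ∧ q (x - i) = q x := by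
    obtain ⟨hxN, hpp, hM, hdvd⟩ := Finset.mem_filter.1 hx
    obtain ⟨hx1, -⟩ := Finset.mem_Icc.1 hxN
    have hq := q_mem hx1
    have hq1 : 1 ≤ q x := le_q (.inr rfl) hx1
    have hgap : (q x).minFac ≤ x - q x ∨ x = q x := by
      rcases hq.2.eq_or_lt with h | h
      · exact .inr h.symm
      · exact .inl (Nat.le_of_dvd (by omega) (Nat.dvd_sub hdvd (Nat.minFac_dvd _)))
    rcases hgap with hgap | hgap
    · exact ⟨by omega, by omega, q_eq_of_le_of_le hx1 (by omega) (Nat.sub_le _ _)⟩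
    · have h1 : q x = 1 := hq.1.resolve_left (hgap ▸ hpp)
      have : M ≤ 1 := by simpa [h1] using hM
      obtain rfl : i = 0 := by omega
      exact ⟨hx1, hx1, rfl⟩
  calc M * A.card = (A ×ˢ Finset.range M).card := by simp [mul_comm]
    _ ≤ (Finset.Icc 1 N).card := by
      refine Finset.card_le_card_of_injOn (fun p ↦ p.1 - p.2) ?_ ?_
      · rintro ⟨x, i⟩ hxi
        obtain ⟨hx, hi⟩ := Finset.mem_product.1 (Finset.mem_coe.1 hxi)
        have := key hx (Finset.mem_range.1 hi)
        have := Finset.mem_Icc.1 (Finset.mem_filter.1 hx).1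
        simp only [Finset.coe_Icc, Set.mem_Icc]
        omega
      · rintro ⟨x, i⟩ hxi ⟨y, j⟩ hyj h
        obtain ⟨hx, hi⟩ := Finset.mem_product.1 (Finset.mem_coe.1 hxi)
        obtain ⟨hy, hj⟩ := Finset.mem_product.1 (Finset.mem_coe.1 hyj)
        simp only [Finset.mem_range] at hx hi hy hj h
        obtain ⟨-, hix, hqx⟩ := key hx hi
        obtain ⟨-, hjy, hqy⟩ := key hy hj
        have hqq : q x = q y := by rw [← hqx, ← hqy, h]
        obtain ⟨-, -, hM, hdx⟩ := Finset.mem_filter.1 hx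
        obtain ⟨-, -, -, hdy⟩ := Finset.mem_filter.1 hy
        rw [hqq] at hdx hM
        have hxy : x = y := by
          have hd : ((q y).minFac : ℤ) ∣ (x : ℤ) - y :=
            dvd_sub (Int.natCast_dvd_natCast.2 hdx) (Int.natCast_dvd_natCast.2 hdy)
          have := Int.eq_zero_of_abs_lt_dvd hd (by rw [abs_lt]; omega)
          omega
        subst hxy
        simp only [Prod.mk.injEq, true_and]
        omega
    _ = N := by simp

lemma exists_card_minFac_q_lt_le (M : ℕ) {ε : ℝ} (hε : 0 < ε) :
    ∃ C : ℕ, ∀ N : ℕ, (((Finset.Icc 1 N).filter fun x ↦ (q x).minFac < M).card : ℝ) ≤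
      C + 2 * ε * M ^ 2 * N := by
  obtain ⟨X, hX⟩ := exists_isPrimePow_between hε
  set Y := max X ⌈ε⁻¹⌉₊
  have hXY : X ≤ Y := le_max_left _ _
  have hεY {n : ℕ} (hn : Y ≤ n) : 1 ≤ ε * n := by
    have : ε⁻¹ ≤ n := (Nat.le_ceil _).trans (by exact_mod_cast (le_max_right _ _).trans hn)
    calc 1 = ε * ε⁻¹ := (mul_inv_cancel₀ hε.ne').symm
      _ ≤ _ := by gcongr
  obtain ⟨C, hCpp, hYC, -⟩ := hX Y hXY
  refine ⟨C, fun N ↦ ?_⟩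
  let I : ℕ → ℕ → Finset ℕ := fun p k ↦
    if Y ≤ p ^ k then Finset.Icc (p ^ k) (p ^ k + ⌊ε * (p ^ k : ℕ)⌋₊) else ∅
  have hI (p k : ℕ) : ((I p k).card : ℝ) ≤ 2 * ε * (p ^ k : ℕ) := by
    simp only [I]
    split_ifs with h
    · have h1 := hεY h
      have h2 := Nat.floor_le (zero_le_one.trans h1)
      rw [Nat.card_Icc, add_assoc, add_tsub_cancel_left, Nat.cast_succ]
      linarith
    · simp only [Finset.card_empty, Nat.cast_zero]
      positivity
  let J : ℕ → Finset ℕ := fun p ↦ (Finset.range (Nat.log p N + 1)).biUnion (I p)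
  have hJ {p : ℕ} (hp : p ∈ (Finset.range M).filter (2 ≤ ·)) (hN : N ≠ 0) :
      ((J p).card : ℝ) ≤ 2 * ε * M * N := by
    obtain ⟨hpM, hp2⟩ := Finset.mem_filter.1 hp
    have hgeom : ∑ k ∈ Finset.range (Nat.log p N + 1), p ^ k ≤ M * N := by
      refine (Nat.geomSum_lt hp2 fun k hk ↦ Finset.mem_range.1 hk).le.trans ?_
      rw [pow_succ, mul_comm]
      exact Nat.mul_le_mul (Finset.mem_range.1 hpM).le (Nat.pow_log_le_self _ hN)
    calc ((J p).card : ℝ) ≤ ∑ k ∈ Finset.range (Nat.log p N + 1), ((I p k).card : ℝ) := by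
          exact_mod_cast Finset.card_biUnion_le
      _ ≤ ∑ k ∈ Finset.range (Nat.log p N + 1), 2 * ε * (p ^ k : ℕ) :=
          Finset.sum_le_sum fun k _ ↦ hI p k
      _ = 2 * ε * (∑ k ∈ Finset.range (Nat.log p N + 1), p ^ k : ℕ) := by
          rw [← Finset.mul_sum]; push_cast; rfl
      _ ≤ 2 * ε * (M * N : ℕ) := by gcongr
      _ = 2 * ε * M * N := by push_cast; ring
  rcases eq_or_ne N 0 with rfl | hN
  · simp
  have hsub : ((Finset.Icc 1 N).filter fun x ↦ (q x).minFac < M) ⊆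
      Finset.Ico 0 C ∪ ((Finset.range M).filter (2 ≤ ·)).biUnion J := by
    intro x hx
    obtain ⟨hxN, hxM⟩ := Finset.mem_filter.1 hx
    obtain ⟨hx1, hxN⟩ := Finset.mem_Icc.1 hxN
    rw [Finset.mem_union]
    refine (lt_or_ge x C).imp (fun h ↦ by simpa using h) fun h ↦ ?_
    have hYq : Y < q x := hYC.trans_le (le_q (.inl hCpp) h)
    obtain ⟨n, hnpp, hqn, hnle⟩ := hX (q x) (hXY.trans hYq.le)
    have hxn : x < n := by
      by_contra! hnx
      exact (le_q (.inl hnpp) hnx).not_gt hqn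
    obtain ⟨p, k, hp, hk, hpk⟩ :=
      (isPrimePow_nat_iff _).1 (isPrimePow_q (hCpp.two_le.trans h))
    have hqx := (q_mem hx1).2
    simp only [Finset.mem_biUnion, Finset.mem_filter, Finset.mem_range, J, I]
    refine ⟨p, ⟨by rwa [← hpk, hp.pow_minFac hk.ne'] at hxM, hp.two_le⟩, k,
      Nat.lt_succ_of_le (Nat.le_log_of_pow_le hp.one_lt (by omega)), ?_⟩
    rw [hpk, if_pos hYq.le, Finset.mem_Icc]
    refine ⟨hqx, ?_⟩
    have : x - q x ≤ ⌊ε * (q x : ℕ)⌋₊ := by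
      refine Nat.le_floor ?_
      rw [Nat.cast_sub hqx]
      have : (x : ℝ) < n := by exact_mod_cast hxn
      linarith
    omega
  calc (((Finset.Icc 1 N).filter fun x ↦ (q x).minFac < M).card : ℝ)
      ≤ ((Finset.Ico 0 C).card + ∑ p ∈ (Finset.range M).filter (2 ≤ ·), (J p).card : ℕ) := by
        exact_mod_cast (Finset.card_le_card hsub).trans
          ((Finset.card_union_le _ _).trans (Nat.add_le_add_left Finset.card_biUnion_le _))
    _ = C + ∑ p ∈ (Finset.range M).filter (2 ≤ ·), ((J p).card : ℝ) := by push_cast; simp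
    _ ≤ C + ∑ p ∈ (Finset.range M).filter (2 ≤ ·), 2 * ε * M * N := by
        gcongr with p hp
        exact hJ hp hN
    _ ≤ C + M * (2 * ε * M * N) := by
        rw [Finset.sum_const, nsmul_eq_mul]
        gcongr
        simpa using Finset.card_filter_le (Finset.range M) (2 ≤ ·)
    _ = C + 2 * ε * M ^ 2 * N := by ring

lemma filter_one_lt_gcd_subset (M N : ℕ) :
    ((Finset.Icc 1 N).filter fun x ↦ 1 < Nat.gcd x (P x)) ⊆
      ((Finset.Icc 1 N).filter fun x ↦ IsPrimePow x ∧ M ≤ x.minFac) ∪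
      ((Finset.Icc 1 N).filter fun x ↦
        ¬IsPrimePow x ∧ M ≤ (q x).minFac ∧ (q x).minFac ∣ x) ∪
      (Finset.Icc 1 N).filter fun x ↦ (q x).minFac < M := by
  intro x hx
  obtain ⟨hxN, hgcd⟩ := Finset.mem_filter.1 hx
  have hx2 : 2 ≤ x := by
    have h1 := (Finset.mem_Icc.1 hxN).1
    rcases h1.eq_or_lt with rfl | h
    · simp at hgcd
    · exact h
  simp only [Finset.mem_union, Finset.mem_filter, hxN, true_and]
  rcases lt_or_ge (q x).minFac M with h | h
  · exact .inr h
  by_cases hpp : IsPrimePow x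
  · exact .inl (.inl ⟨hpp, by rwa [q_eq_self hpp] at h⟩)
  · exact .inl (.inr ⟨hpp, h, minFac_q_dvd_of_one_lt_gcd hx2 hpp hgcd⟩)

end

theorem stmt_11 :
    Filter.Tendsto
      (fun N : ℕ => (((Finset.Icc 1 N).filter (fun x => 1 < Nat.gcd x (P x))).card : ℝ) / N)
      Filter.atTop (nhds 0) := by
  rw [Metric.tendsto_atTop]
  intro η hη
  have hlog : Filter.Tendsto (fun M : ℕ ↦ Real.log M) Filter.atTop Filter.atTop :=
    Real.tendsto_log_atTop.comp tendsto_natCast_atTop_atTop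
  obtain ⟨M, hM2, hMη, hMlog⟩ := ((Filter.eventually_ge_atTop 2).and
    ((tendsto_natCast_atTop_atTop.eventually_ge_atTop (8 / η)).and
      (hlog.eventually_ge_atTop (8 * (Real.log 4 + 4) / η)))).exists
  have hM0 : (0 : ℝ) < M := by positivity
  have hε : 0 < η / (16 * M ^ 2) := by positivity
  obtain ⟨C, hC⟩ := exists_card_minFac_q_lt_le M hε
  obtain ⟨N₀, hN₀⟩ := exists_nat_gt (8 * C / η)
  refine ⟨max N₀ 1, fun N hN ↦ ?_⟩
  have hN1 : (0 : ℝ) < N := by exact_mod_cast (le_max_right _ _).trans hN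
  have hNC : 8 * C / η < N := hN₀.trans_le (by exact_mod_cast (le_max_left _ _).trans hN)
  have h0 := Nat.cast_le (α := ℝ).2 ((Finset.card_le_card (filter_one_lt_gcd_subset M N)).trans
    ((Finset.card_union_le _ _).trans (Nat.add_le_add_right (Finset.card_union_le _ _) _)))
  have h1 := card_isPrimePow_mul_log_le M N
  have h2 := Nat.cast_le (α := ℝ).2 (mul_card_minFac_q_dvd_le M N)
  have h3 := hC N
  have h3' : 2 * (η / (16 * (M : ℝ) ^ 2)) * M ^ 2 * N = η / 8 * N := by field_simp; norm_num
  rw [h3'] at h3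
  push_cast at h0 h2
  set a₁ := (((Finset.Icc 1 N).filter fun x ↦ IsPrimePow x ∧ M ≤ x.minFac).card : ℝ)
  set a₂ := (((Finset.Icc 1 N).filter fun x ↦
    ¬IsPrimePow x ∧ M ≤ (q x).minFac ∧ (q x).minFac ∣ x).card : ℝ)
  have hL : 0 < Real.log 4 + 4 := by positivity
  have ha₁ : a₁ ≤ η / 8 * N := by
    have h : a₁ * (8 * (Real.log 4 + 4) / η) ≤ (Real.log 4 + 4) * N :=
      (mul_le_mul_of_nonneg_left hMlog (by positivity)).trans h1
    have h' : a₁ * (8 * (Real.log 4 + 4) / η) * (η / (8 * (Real.log 4 + 4))) ≤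
      (Real.log 4 + 4) * N * (η / (8 * (Real.log 4 + 4))) := by gcongr
    field_simp at h' ⊢
    linarith
  have ha₂ : a₂ ≤ η / 8 * N := by
    have h : 8 / η * a₂ ≤ N := (mul_le_mul_of_nonneg_right hMη (by positivity)).trans h2
    rw [div_mul_eq_mul_div, div_le_iff₀ hη] at h
    linarith
  have hC' : (C : ℝ) ≤ η / 8 * N := by
    rw [div_lt_iff₀ hη] at hNC
    linarith
  rw [Real.dist_0_eq_abs, abs_of_nonneg (by positivity), div_lt_iff₀ hN1]
  nlinarith [mul_pos hη hN1]
end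

section
/- Fix a prime p. The Cesàro means Ṫ_p(x) = (1/x)∑_{t=1}^{x} T_p(t) and Ṡ_p(x) = (1/x)∑_{t=1}^{x} S_p(t) satisfy Ṫ_p(x) ∼ (p−1)·ln x/(2 ln p) and Ṡ_p(x) ∼ (p−1)·ln x/(2 ln p) as x → ∞ (where f(x) ∼ g(x) means f(x)/g(x) → 1). -/
open scoped Classical

/-- The map `P_p`: fixes `1, …, p−1`, divides powers of `p` by `p`, and otherwise
subtracts the largest power of `p` not exceeding the argument. -/
noncomputable def Pp (p x : ℕ) : ℕ :=
  if x ≤ p - 1 then x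
  else if ∃ k : ℕ, x = p ^ k then x / p
  else x - sSup {m : ℕ | (∃ k : ℕ, m = p ^ k) ∧ m ≤ x}

/-- The orbit of `x` under `P_p`: `orbitp p x 1 = x`, `orbitp p x (n+1) = P_p (orbitp p x n)`. -/
noncomputable def orbitp (p x n : ℕ) : ℕ := (Pp p)^[n - 1] x

/-- The transient length `T_p x = min {n ≥ 1 : x_n ∈ {1,…,p−1}}`. -/
noncomputable def Tp (p x : ℕ) : ℕ :=
  sInf {n : ℕ | 1 ≤ n ∧ 1 ≤ orbitp p x n ∧ orbitp p x n ≤ p - 1}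

/-- The limit `L_p x = x_{T_p x}`. -/
noncomputable def Lp (p x : ℕ) : ℕ := orbitp p x (Tp p x)

/-- The settling time `S_p x = min {n ≥ 1 : x_n ∈ {1,…,p−1} ∪ {p^k : k ≥ 1}}`. -/
noncomputable def Sp (p x : ℕ) : ℕ :=
  sInf {n : ℕ | 1 ≤ n ∧
    ((1 ≤ orbitp p x n ∧ orbitp p x n ≤ p - 1) ∨ ∃ k : ℕ, 1 ≤ k ∧ orbitp p x n = p ^ k)}

/-- The attractor `A_p x = x_{S_p x}`. -/
noncomputable def Ap (p x : ℕ) : ℕ := orbitp p x (Sp p x)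

/-- `𝒮*_p(x)`: the sum of the base-`p` digits of `x` minus `x mod p`. -/
def Sstar (p x : ℕ) : ℕ := (Nat.digits p x).sum - x % p

section DigitSum

variable {p : ℕ}

lemma digits_sum_eq_mod_add (hp : 1 < p) (x : ℕ) :
    (Nat.digits p x).sum = x % p + (Nat.digits p (x / p)).sum := by
  rcases Nat.eq_zero_or_pos x with rfl | hx
  · simp
  · rw [Nat.digits_def' hp hx, List.sum_cons]

lemma digits_sum_mul_add (hp : 1 < p) (M : ℕ) {j : ℕ} (hj : j < p) :
    (Nat.digits p (p * M + j)).sum = (Nat.digits p M).sum + j := by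
  rw [digits_sum_eq_mod_add hp, Nat.mul_add_mod, Nat.mod_eq_of_lt hj,
    Nat.mul_add_div (by omega), Nat.div_eq_of_lt hj]
  simp [add_comm]

lemma digits_sum_pow (hp : 1 < p) (k : ℕ) : (Nat.digits p (p ^ k)).sum = 1 := by
  induction k with
  | zero => simp [Nat.digits_of_lt p 1 one_ne_zero hp]
  | succ k ih => simpa [pow_succ', ih] using digits_sum_mul_add hp (p ^ k) (j := 0) (by omega)

lemma digits_sum_sub_leading (hp : 1 < p) {x : ℕ} (hx : 1 ≤ x) :
    (Nat.digits p x).sum = (Nat.digits p (x - p ^ Nat.log p x)).sum + 1 := by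
  induction x using Nat.strong_induction_on with
  | _ x ih =>
    rcases lt_or_ge x p with h | h
    · have hdig (y : ℕ) (hy : y < p) : (Nat.digits p y).sum = y := by
        simpa using digits_sum_mul_add hp 0 hy
      rw [Nat.log_of_lt h, pow_zero, hdig x h, hdig _ (by omega)]
      omega
    · have hdiv : 1 ≤ x / p := Nat.div_pos h (by omega)
      have hlog : Nat.log p x = Nat.log p (x / p) + 1 := Nat.log_of_one_lt_of_le hp h
      have hle : p ^ Nat.log p (x / p) ≤ x / p := Nat.pow_log_le_self p (by omega)
      have hsub : x - p ^ Nat.log p x = p * (x / p - p ^ Nat.log p (x / p)) + x % p := by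
        have := Nat.div_add_mod x p
        have := Nat.mul_le_mul_left p hle
        rw [hlog, pow_succ', Nat.mul_sub]
        omega
      rw [hsub, digits_sum_mul_add hp _ (Nat.mod_lt _ (by omega)), digits_sum_eq_mod_add hp x,
        ih _ (Nat.div_lt_self hx hp) hdiv]
      omega

lemma digits_sum_le_mul_length (hp : 1 < p) (x : ℕ) :
    (Nat.digits p x).sum ≤ (p - 1) * (Nat.digits p x).length := by
  have := List.sum_le_card_nsmul (Nat.digits p x) (p - 1)
    fun d hd => Nat.le_sub_one_of_lt (Nat.digits_lt_base hp hd)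
  simpa [mul_comm] using this

lemma two_mul_sum_range_digits_sum_mul_add (hp : 1 < p) (M r : ℕ) (hr : r ≤ p) :
    2 * ∑ t ∈ Finset.range (p * M + r), ((Nat.digits p t).sum : ℝ) =
      2 * ∑ t ∈ Finset.range (p * M), ((Nat.digits p t).sum : ℝ) +
        2 * r * (Nat.digits p M).sum + r * (r - 1) := by
  induction r with
  | zero => simp
  | succ r ih =>
    rw [← add_assoc, Finset.sum_range_succ, mul_add, ih (by omega),
      digits_sum_mul_add hp M (by omega)]
    push_cast
    ring

lemma two_mul_sum_range_mul_digits_sum (hp : 1 < p) (M : ℕ) :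
    2 * ∑ t ∈ Finset.range (p * M), ((Nat.digits p t).sum : ℝ) =
      2 * p * ∑ t ∈ Finset.range M, ((Nat.digits p t).sum : ℝ) + M * p * (p - 1) := by
  induction M with
  | zero => simp
  | succ M ih =>
    rw [mul_add, mul_one, two_mul_sum_range_digits_sum_mul_add hp M p le_rfl, ih,
      Finset.sum_range_succ]
    push_cast
    ring

lemma abs_sum_range_digits_sum_sub_le (hp : 1 < p) (N : ℕ) :
    |2 * ∑ t ∈ Finset.range N, ((Nat.digits p t).sum : ℝ) -
      N * (p - 1) * (Nat.digits p N).length| ≤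
      2 * p ^ 2 * N - p ^ 2 * (Nat.digits p N).length := by
  induction N using Nat.strong_induction_on with
  | _ N ih =>
    rcases Nat.eq_zero_or_pos N with rfl | hN
    · simp
    have hM := ih (N / p) (Nat.div_lt_self hN hp)
    have hlen : (Nat.digits p N).length = (Nat.digits p (N / p)).length + 1 := by
      rw [Nat.digits_def' hp hN, List.length_cons]
    have hr : N % p < p := Nat.mod_lt _ (by omega)
    have hN' := Nat.div_add_mod N p
    have hs := digits_sum_le_mul_length hp (N / p)
    have hpos : N % p = 0 → 1 ≤ (Nat.digits p (N / p)).length := by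
      intro h0
      rw [Nat.one_le_iff_ne_zero, ne_eq, List.length_eq_zero_iff, Nat.digits_eq_nil_iff_eq_zero]
      intro h1
      rw [h0, h1] at hN'
      omega
    have hD : 2 * ∑ t ∈ Finset.range N, ((Nat.digits p t).sum : ℝ) = _ :=
      hN' ▸ two_mul_sum_range_digits_sum_mul_add hp (N / p) (N % p) hr.le
    rw [two_mul_sum_range_mul_digits_sum hp] at hD
    rw [hD, hlen]
    have hNR : (N : ℝ) = p * (N / p : ℕ) + (N % p : ℕ) := by exact_mod_cast hN'.symm
    have hsR : ((Nat.digits p (N / p)).sum : ℝ) ≤ (p - 1) * (Nat.digits p (N / p)).length := by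
      have := (Nat.cast_le (α := ℝ)).2 hs
      rwa [Nat.cast_mul, Nat.cast_sub hp.le, Nat.cast_one] at this
    rw [hNR]
    generalize ∑ t ∈ Finset.range (N / p), ((Nat.digits p t).sum : ℝ) = A at *
    generalize (Nat.digits p (N / p)).sum = s at *
    generalize (Nat.digits p (N / p)).length = L at *
    generalize N / p = M at *
    generalize N % p = r at *
    have hpR : (2 : ℝ) ≤ p := by exact_mod_cast hp
    have hrR : (r : ℝ) ≤ p := by exact_mod_cast hr.le
    have hr0 : (0 : ℝ) ≤ r := r.cast_nonneg
    have hs0 : (0 : ℝ) ≤ s := s.cast_nonneg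
    have hL0 : (0 : ℝ) ≤ L := L.cast_nonneg
    set e : ℝ := r * (2 * s - (p - 1) * L + r - p) with he
    have hsplit : 2 * (p : ℝ) * A + M * p * (p - 1) + 2 * r * s + r * (r - 1) -
        (p * M + r) * (p - 1) * (L + 1 : ℕ) = p * (2 * A - M * (p - 1) * L) + e := by
      push_cast
      ring
    have hbound : |e| + p ^ 2 * (L + 1) ≤ p * (p ^ 2 * L) + 2 * p ^ 2 * r := by
      rcases Nat.eq_zero_or_pos r with rfl | hrpos
      · have hL1 : (1 : ℝ) ≤ L := by exact_mod_cast hpos rfl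
        have : (L : ℝ) + 1 ≤ p * L := by nlinarith
        have := mul_le_mul_of_nonneg_left this (sq_nonneg (p : ℝ))
        simp only [he, Nat.cast_zero, zero_mul, abs_zero]
        linarith
      · have hr1 : (1 : ℝ) ≤ r := by exact_mod_cast hrpos
        have hinner : |2 * (s : ℝ) - (p - 1) * L + r - p| ≤ (p : ℝ) * (L + 1) := by
          rw [abs_le]
          constructor <;> nlinarith
        have hle : |e| ≤ p * (p * (L + 1)) := by
          rw [he, abs_mul, abs_of_nonneg hr0]
          exact mul_le_mul hrR hinner (abs_nonneg _) (by positivity)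
        have h1 := mul_le_mul_of_nonneg_left hr1 (sq_nonneg (p : ℝ))
        have h2 := mul_le_mul_of_nonneg_right hpR (mul_nonneg (sq_nonneg (p : ℝ)) hL0)
        linarith
    rw [hsplit]
    refine (abs_add_le _ _).trans ?_
    rw [abs_mul, abs_of_nonneg (by linarith : (0 : ℝ) ≤ p)]
    have := mul_le_mul_of_nonneg_left hM (by linarith : (0 : ℝ) ≤ p)
    push_cast
    linarith

end DigitSum

section Orbit

variable {p : ℕ}

lemma Pp_of_lt {x : ℕ} (h : x < p) : Pp p x = x :=
  if_pos (by omega)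

lemma Pp_pow (hp : 1 < p) (k : ℕ) : Pp p (p ^ (k + 1)) = p ^ k := by
  have h : p ≤ p ^ (k + 1) := Nat.le_self_pow (by omega) p
  rw [Pp, if_neg (by omega), if_pos ⟨_, rfl⟩, pow_succ, Nat.mul_div_cancel _ (by omega)]

lemma Pp_of_not_pow (hp : 1 < p) {x : ℕ} (hx : p ≤ x) (h : ¬ ∃ k : ℕ, x = p ^ k) :
    Pp p x = x - p ^ Nat.log p x := by
  have hmax : IsGreatest {m : ℕ | (∃ k : ℕ, m = p ^ k) ∧ m ≤ x} (p ^ Nat.log p x) := by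
    refine ⟨⟨⟨_, rfl⟩, Nat.pow_log_le_self p (by omega)⟩, ?_⟩
    rintro _ ⟨⟨k, rfl⟩, hk⟩
    exact Nat.pow_le_pow_right (by omega) (Nat.le_log_of_pow_le hp hk)
  rw [Pp, if_neg (by omega), if_neg h, hmax.csSup_eq]

lemma digits_sum_le_digits_sum_Pp_add_one (hp : 1 < p) (x : ℕ) :
    (Nat.digits p x).sum ≤ (Nat.digits p (Pp p x)).sum + 1 := by
  rcases lt_or_ge x p with hx | hx
  · rw [Pp_of_lt hx]
    omega
  by_cases h : ∃ k : ℕ, x = p ^ k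
  · obtain ⟨k, rfl⟩ := h
    rw [digits_sum_pow hp]
    omega
  · rw [Pp_of_not_pow hp hx h, ← digits_sum_sub_leading hp (by omega)]

lemma digits_sum_le_digits_sum_iterate_Pp_add (hp : 1 < p) (n x : ℕ) :
    (Nat.digits p x).sum ≤ (Nat.digits p ((Pp p)^[n] x)).sum + n := by
  induction n generalizing x with
  | zero => simp
  | succ n ih =>
    have h1 := digits_sum_le_digits_sum_Pp_add_one hp x
    have h2 := ih (Pp p x)
    rw [Function.iterate_succ_apply]
    omega

lemma exists_iterate_Pp_mem (hp : p.Prime) {x : ℕ} (hx : 1 ≤ x) :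
    ∃ n, n + 1 ≤ (Nat.digits p x).sum + padicValNat p x ∧
      1 ≤ (Pp p)^[n] x ∧ (Pp p)^[n] x ≤ p - 1 := by
  have : Fact p.Prime := ⟨hp⟩
  have hp1 := hp.one_lt
  induction x using Nat.strong_induction_on with
  | _ x ih =>
    rcases lt_or_ge x p with hlt | hge
    · have := digits_sum_sub_leading hp1 hx
      exact ⟨0, by omega, hx, by simp; omega⟩
    suffices h : 1 ≤ Pp p x ∧ Pp p x < x ∧
        (Nat.digits p (Pp p x)).sum + padicValNat p (Pp p x) + 1 ≤
          (Nat.digits p x).sum + padicValNat p x by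
      obtain ⟨n, hn, hmem⟩ := ih _ h.2.1 h.1
      exact ⟨n + 1, by omega, hmem⟩
    by_cases hpow : ∃ k : ℕ, x = p ^ k
    · obtain ⟨k, rfl⟩ := hpow
      obtain _ | k := k
      · simp at hge
        omega
      · rw [Pp_pow hp1, digits_sum_pow hp1, digits_sum_pow hp1, padicValNat.prime_pow,
          padicValNat.prime_pow]
        exact ⟨Nat.one_le_pow _ _ (by omega), Nat.pow_lt_pow_right hp1 (by omega), by omega⟩
    · have hle : p ^ Nat.log p x ≤ x := Nat.pow_log_le_self p (by omega)
      have hne : x ≠ p ^ Nat.log p x := fun h => hpow ⟨_, h⟩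
      have hpos : 1 ≤ p ^ Nat.log p x := Nat.one_le_pow _ _ (by omega)
      rw [Pp_of_not_pow hp1 hge hpow, digits_sum_sub_leading hp1 hx]
      set y := x - p ^ Nat.log p x with hy
      have hval : padicValNat p y ≤ padicValNat p x := by
        have hdvd : p ^ padicValNat p y ∣ y := pow_padicValNat_dvd
        have hlog : padicValNat p y ≤ Nat.log p x :=
          Nat.le_log_of_pow_le hp1 ((Nat.le_of_dvd (by omega) hdvd).trans (by omega))
        refine (padicValNat_dvd_iff_le (by omega)).1 ?_
        have := dvd_add hdvd (pow_dvd_pow p hlog)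
        rwa [hy, Nat.sub_add_cancel hle] at this
      exact ⟨by omega, by omega, by omega⟩

lemma Tp_mem (hp : p.Prime) {x : ℕ} (hx : 1 ≤ x) :
    1 ≤ Tp p x ∧ 1 ≤ orbitp p x (Tp p x) ∧ orbitp p x (Tp p x) ≤ p - 1 := by
  obtain ⟨n, -, hn⟩ := exists_iterate_Pp_mem hp hx
  exact Nat.sInf_mem (s := {n : ℕ | 1 ≤ n ∧ 1 ≤ orbitp p x n ∧ orbitp p x n ≤ p - 1})
    ⟨n + 1, by omega, hn⟩

lemma Tp_le_digits_sum_add (hp : p.Prime) {x : ℕ} (hx : 1 ≤ x) :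
    Tp p x ≤ (Nat.digits p x).sum + padicValNat p x := by
  obtain ⟨n, hle, hn⟩ := exists_iterate_Pp_mem hp hx
  have h : Tp p x ≤ n + 1 := Nat.sInf_le ⟨by omega, hn⟩
  exact h.trans hle

lemma Sp_le_Tp (hp : p.Prime) {x : ℕ} (hx : 1 ≤ x) : Sp p x ≤ Tp p x :=
  have h := Tp_mem hp hx
  Nat.sInf_le ⟨h.1, Or.inl h.2⟩

lemma digits_sum_le_Sp_add (hp : p.Prime) {x : ℕ} (hx : 1 ≤ x) :
    (Nat.digits p x).sum ≤ Sp p x + p := by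
  have hp1 := hp.one_lt
  have hT := Tp_mem hp hx
  obtain ⟨-, hS⟩ : 1 ≤ Sp p x ∧ ((1 ≤ orbitp p x (Sp p x) ∧ orbitp p x (Sp p x) ≤ p - 1) ∨
      ∃ k : ℕ, 1 ≤ k ∧ orbitp p x (Sp p x) = p ^ k) :=
    Nat.sInf_mem (s := {n : ℕ | 1 ≤ n ∧
      ((1 ≤ orbitp p x n ∧ orbitp p x n ≤ p - 1) ∨ ∃ k : ℕ, 1 ≤ k ∧ orbitp p x n = p ^ k)})
      ⟨_, hT.1, Or.inl hT.2⟩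
  have h := digits_sum_le_digits_sum_iterate_Pp_add hp1 (Sp p x - 1) x
  change _ ≤ (Nat.digits p (orbitp p x (Sp p x))).sum + _ at h
  have hend : (Nat.digits p (orbitp p x (Sp p x))).sum ≤ p := by
    rcases hS with hS | ⟨k, -, hk⟩
    · have := Nat.digit_sum_le p (orbitp p x (Sp p x))
      omega
    · rw [hk, digits_sum_pow hp1]
      omega
  omega

end Orbit

lemma sum_padicValNat_Icc_le {p : ℕ} (hp : p.Prime) (x : ℕ) :
    ∑ t ∈ Finset.Icc 1 x, padicValNat p t ≤ x := by
  have : Fact p.Prime := ⟨hp⟩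
  have hfact : ∑ t ∈ Finset.Icc 1 x, padicValNat p t = padicValNat p x.factorial := by
    induction x with
    | zero => simp
    | succ x ih =>
      rw [Finset.sum_Icc_succ_top (by omega), ih, Nat.factorial_succ,
        padicValNat.mul (by omega) (Nat.factorial_ne_zero x), add_comm]
  have h := sub_one_mul_padicValNat_factorial (p := p) x
  have hp1 : 1 ≤ p - 1 := by have := hp.one_lt; omega
  rw [hfact]
  calc padicValNat p x.factorial ≤ (p - 1) * padicValNat p x.factorial :=
        Nat.le_mul_of_pos_left _ hp1
    _ ≤ x := by rw [h]; exact Nat.sub_le _ _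

lemma abs_length_digits_sub_log_div_log_le {p x : ℕ} (hp : 1 < p) (hx : 1 ≤ x) :
    |((Nat.digits p x).length : ℝ) - Real.log x / Real.log p| ≤ 1 := by
  have hlogp : 0 < Real.log p := Real.log_pos (by exact_mod_cast hp)
  rw [Nat.length_digits p x hp (by omega)]
  have h1 : (Nat.log p x : ℝ) ≤ Real.log x / Real.log p := by
    rw [le_div_iff₀ hlogp, ← Real.log_pow]
    exact Real.log_le_log (by positivity) (by exact_mod_cast Nat.pow_log_le_self p (by omega))
  have h2 : Real.log x / Real.log p ≤ (Nat.log p x : ℝ) + 1 := by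
    rw [div_le_iff₀ hlogp, ← Nat.cast_succ, ← Real.log_pow]
    exact Real.log_le_log (by positivity)
      (by exact_mod_cast (Nat.lt_pow_succ_log_self hp x).le)
  rw [abs_le]
  push_cast
  constructor <;> linarith

lemma abs_sum_Icc_digits_sum_sub_le {p : ℕ} (hp : 1 < p) {x : ℕ} (hx : 1 ≤ x) :
    |((∑ t ∈ Finset.Icc 1 x, (Nat.digits p t).sum : ℕ) : ℝ) -
      x * (((p : ℝ) - 1) * Real.log x / (2 * Real.log p))| ≤ (p ^ 2 + p + 1) * x := by
  have hsum : ((∑ t ∈ Finset.Icc 1 x, (Nat.digits p t).sum : ℕ) : ℝ) =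
      ∑ t ∈ Finset.range x, ((Nat.digits p t).sum : ℝ) + (Nat.digits p x).sum := by
    rw [← Finset.sum_range_succ, Finset.range_eq_Ico, Finset.sum_eq_sum_Ico_succ_bot (by omega)]
    push_cast
    simp [← Finset.Ico_succ_right_eq_Icc]
  have hx0 : (0 : ℝ) ≤ x := x.cast_nonneg
  have hp0 : (0 : ℝ) ≤ (p : ℝ) - 1 := by
    have : (1 : ℝ) < p := by exact_mod_cast hp
    linarith
  have hs : ((Nat.digits p x).sum : ℝ) ≤ x := by exact_mod_cast Nat.digit_sum_le p x
  have hs0 : (0 : ℝ) ≤ (Nat.digits p x).sum := Nat.cast_nonneg _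
  have hL0 : (0 : ℝ) ≤ p ^ 2 * (Nat.digits p x).length := by positivity
  have hD := abs_le.1 (abs_sum_range_digits_sum_sub_le hp x)
  have hL := abs_le.1 (abs_length_digits_sub_log_div_log_le hp hx)
  have h1 := mul_le_mul_of_nonneg_left hL.1 (mul_nonneg hx0 hp0)
  have h2 := mul_le_mul_of_nonneg_left hL.2 (mul_nonneg hx0 hp0)
  have hmain : (x : ℝ) * (((p : ℝ) - 1) * Real.log x / (2 * Real.log p)) =
      x * (p - 1) * (Real.log x / Real.log p) / 2 := by
    rw [mul_comm 2, ← div_div]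
    ring
  rw [hsum, hmain, abs_le]
  constructor <;> nlinarith

lemma tendsto_div_div_of_abs_sub_le {F g : ℕ → ℝ} {K : ℝ}
    (hg : Filter.Tendsto g Filter.atTop Filter.atTop)
    (h : ∀ x : ℕ, 1 ≤ x → |F x - x * g x| ≤ K * x) :
    Filter.Tendsto (fun x : ℕ => F x / x / g x) Filter.atTop (nhds 1) := by
  rw [tendsto_iff_norm_sub_tendsto_zero]
  refine squeeze_zero' (Filter.Eventually.of_forall fun _ => norm_nonneg _) ?_
    (hg.const_div_atTop K)
  filter_upwards [hg.eventually_gt_atTop 0, Filter.eventually_ge_atTop 1] with x hgx hx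
  have hx0 : (0 : ℝ) < x := by exact_mod_cast hx
  have heq : F x / x / g x - 1 = (F x - x * g x) / (x * g x) := by
    field_simp
  rw [heq, Real.norm_eq_abs, abs_div, abs_of_pos (mul_pos hx0 hgx),
    div_le_div_iff₀ (mul_pos hx0 hgx) hgx]
  have := mul_le_mul_of_nonneg_right (h x hx) hgx.le
  linarith

lemma tendsto_sum_div_div_of_bounds {p : ℕ} (hp : p.Prime) {f : ℕ → ℕ}
    (hlow : ∀ t, 1 ≤ t → (Nat.digits p t).sum ≤ f t + p)
    (hupp : ∀ t, 1 ≤ t → f t ≤ (Nat.digits p t).sum + padicValNat p t) :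
    Filter.Tendsto
      (fun x : ℕ => ((∑ t ∈ Finset.Icc 1 x, f t : ℕ) : ℝ) / x /
        (((p : ℝ) - 1) * Real.log x / (2 * Real.log p)))
      Filter.atTop (nhds 1) := by
  have hp1 : (1 : ℝ) < p := by exact_mod_cast hp.one_lt
  have hlogp : 0 < Real.log p := Real.log_pos hp1
  refine tendsto_div_div_of_abs_sub_le (K := p ^ 2 + 2 * p + 2) ?_ fun x hx => ?_
  · exact ((Real.tendsto_log_atTop.comp tendsto_natCast_atTop_atTop).const_mul_atTop
      (by linarith)).atTop_div_const (by positivity)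
  · have h1 : ∑ t ∈ Finset.Icc 1 x, (Nat.digits p t).sum ≤ ∑ t ∈ Finset.Icc 1 x, f t + x * p := by
      have := Finset.sum_le_sum fun t (ht : t ∈ Finset.Icc 1 x) => hlow t (Finset.mem_Icc.1 ht).1
      simpa [Finset.sum_add_distrib] using this
    have h2 : ∑ t ∈ Finset.Icc 1 x, f t ≤ ∑ t ∈ Finset.Icc 1 x, (Nat.digits p t).sum + x := by
      have := Finset.sum_le_sum fun t (ht : t ∈ Finset.Icc 1 x) => hupp t (Finset.mem_Icc.1 ht).1
      rw [Finset.sum_add_distrib] at this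
      have := sum_padicValNat_Icc_le hp x
      omega
    have h1' : ((∑ t ∈ Finset.Icc 1 x, (Nat.digits p t).sum : ℕ) : ℝ) ≤
        (∑ t ∈ Finset.Icc 1 x, f t : ℕ) + x * p := by exact_mod_cast h1
    have h2' : ((∑ t ∈ Finset.Icc 1 x, f t : ℕ) : ℝ) ≤
        (∑ t ∈ Finset.Icc 1 x, (Nat.digits p t).sum : ℕ) + x := by exact_mod_cast h2
    have h3 := abs_le.1 (abs_sum_Icc_digits_sum_sub_le hp.one_lt hx)
    have hx0 : (0 : ℝ) ≤ x := x.cast_nonneg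
    have hpx : (0 : ℝ) ≤ p * x := by positivity
    rw [abs_le]
    constructor <;> linarith

theorem stmt_19 (p : ℕ) (hp : p.Prime) :
    Filter.Tendsto
      (fun x : ℕ => ((∑ t ∈ Finset.Icc 1 x, Tp p t : ℕ) : ℝ) / x /
        (((p : ℝ) - 1) * Real.log x / (2 * Real.log p)))
      Filter.atTop (nhds 1) ∧
    Filter.Tendsto
      (fun x : ℕ => ((∑ t ∈ Finset.Icc 1 x, Sp p t : ℕ) : ℝ) / x /
        (((p : ℝ) - 1) * Real.log x / (2 * Real.log p)))
      Filter.atTop (nhds 1) := by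
  refine ⟨tendsto_sum_div_div_of_bounds hp (fun t ht => ?_) (fun t ht => Tp_le_digits_sum_add hp ht),
    tendsto_sum_div_div_of_bounds hp (fun t ht => digits_sum_le_Sp_add hp ht)
      (fun t ht => (Sp_le_Tp hp ht).trans (Tp_le_digits_sum_add hp ht))⟩
  have := digits_sum_le_Sp_add hp ht
  have := Sp_le_Tp hp ht
  omega
end
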